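/- arXiv:math/0403057 — 2 statements merged into one kernel-verified Lean document; each statement's English description precedes it below -/
import Mathlib

section
/- Let S be a conical refinement commutative monoid and let p, q be projections of S with p(q(x)) = 0 for all x ∈ S. Then the pointwise sum r : x ↦ p(x) + q(x) is a projection of S; moreover p(x) ≤ r(x) and q(x) ≤ r(x) for all x ∈ S, and every projection t of S satisfying p(x) ≤ t(x) and q(x) ≤ t(x) for all x ∈ S satisfies r(x) ≤ t(x) for all x ∈ S (that is, r is the join of p and q in the pointwise order on projections). -/
namespace PaperCDS

variable {M : Type*} [AddCommMonoid M]

/-- The algebraic preorder: `a ≤ b` iff `a + c = b` for some `c`. -/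
def algLe (a b : M) : Prop := ∃ c : M, a + c = b

/-- `S` is conical if `a + b = 0` implies `a = 0` and `b = 0`. -/
def Conical (M : Type*) [AddCommMonoid M] : Prop :=
  ∀ a b : M, a + b = 0 → a = 0 ∧ b = 0

/-- The refinement property. -/
def Refinement (M : Type*) [AddCommMonoid M] : Prop :=
  ∀ a₀ a₁ b₀ b₁ : M, a₀ + a₁ = b₀ + b₁ →
    ∃ c₀₀ c₀₁ c₁₀ c₁₁ : M,
      a₀ = c₀₀ + c₀₁ ∧ a₁ = c₁₀ + c₁₁ ∧ b₀ = c₀₀ + c₁₀ ∧ b₁ = c₀₁ + c₁₁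

/-- Orthogonality: `a ⊥ b` iff the only `x` with `x ≤ a` and `x ≤ b` is `0`. -/
def Orth (a b : M) : Prop := ∀ x : M, algLe x a → algLe x b → x = 0

/-- `X^⊥ = {s : s ⊥ x for all x ∈ X}`. -/
def perpSet (X : Set M) : Set M := {s : M | ∀ x ∈ X, Orth s x}

/-- An ideal: a nonempty subset `I` with `a + b ∈ I ↔ a ∈ I ∧ b ∈ I`. -/
def IsIdeal (I : Set M) : Prop :=
  I.Nonempty ∧ ∀ a b : M, a + b ∈ I ↔ a ∈ I ∧ b ∈ I

/-- An additive endomorphism. -/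
def IsAddEndo (p : M → M) : Prop :=
  p 0 = 0 ∧ ∀ x y : M, p (x + y) = p x + p y

/-- A projection: an additive endomorphism `p` such that every `x` can be written
`x = p x + y` with `y` orthogonal to every element of the range of `p`. -/
def IsProjection (p : M → M) : Prop :=
  IsAddEndo p ∧ ∀ x : M, ∃ y : M, x = p x + y ∧ ∀ s : M, Orth y (p s)

/-- A complementary pair of projections. -/
def ComplPair (p q : M → M) : Prop :=
  IsAddEndo p ∧ IsAddEndo q ∧
    ∀ x : M, p x + q x = x ∧ p (q x) = 0 ∧ q (p x) = 0

/-- General comparability. -/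
def GenComp (M : Type*) [AddCommMonoid M] : Prop :=
  ∀ a b : M, ∃ p q : M → M, ComplPair p q ∧ algLe (p a) (p b) ∧ algLe (q b) (q a)

/-- `S` is Boolean-valued. -/
def BoolValued (M : Type*) [AddCommMonoid M] : Prop :=
  ∀ a b : M, ∃ p q : M → M, ComplPair p q ∧ algLe (p a) (p b) ∧
    ∀ p' q' : M → M, ComplPair p' q' → algLe (p' a) (p' b) →
      ∀ x : M, algLe (p' x) (p x)

/-- Directly finite element. -/
def DirectlyFinite (c : M) : Prop := ∀ x : M, x + c = c → x = 0

/-- Purely infinite element. -/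
def PurelyInfinite (c : M) : Prop := c + c = c

/-- `b` is an infimum of `X` for the algebraic preorder. -/
def IsInfOf (b : M) (X : Set M) : Prop :=
  (∀ x ∈ X, algLe b x) ∧ ∀ y : M, (∀ x ∈ X, algLe y x) → algLe y b

/-- `b` is a supremum of `X` for the algebraic preorder. -/
def IsSupOf (b : M) (X : Set M) : Prop :=
  (∀ x ∈ X, algLe x b) ∧ ∀ y : M, (∀ x ∈ X, algLe x y) → algLe b y

/-- Antisymmetry of the algebraic preorder. -/
def Antisymm (M : Type*) [AddCommMonoid M] : Prop :=
  ∀ a b : M, algLe a b → algLe b a → a = b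

/-- Axiom (M5): every element is the sum of a directly finite element and a
purely infinite element. -/
def AxiomM5 (M : Type*) [AddCommMonoid M] : Prop :=
  ∀ a : M, ∃ x y : M, DirectlyFinite x ∧ PurelyInfinite y ∧ a = x + y

/-- Axiom (M2): every nonempty subset has an infimum. -/
def AxiomM2 (M : Type*) [AddCommMonoid M] : Prop :=
  ∀ X : Set M, X.Nonempty → ∃ b : M, IsInfOf b X

theorem algLe.trans {a b c : M} (hab : algLe a b) (hbc : algLe b c) : algLe a c := by
  obtain ⟨d, rfl⟩ := hab
  obtain ⟨e, rfl⟩ := hbc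
  exact ⟨d + e, (add_assoc a d e).symm⟩

theorem algLe_add_right (a b : M) : algLe a (a + b) := ⟨b, rfl⟩

theorem algLe_add_left (a b : M) : algLe b (a + b) := ⟨a, add_comm b a⟩

theorem algLe_refl (a : M) : algLe a a := ⟨0, add_zero a⟩

theorem Conical.eq_zero_of_algLe (hCon : Conical M) {a b : M} (hab : algLe a b) (hb : b = 0) :
    a = 0 := by
  obtain ⟨c, rfl⟩ := hab
  exact (hCon a c hb).1

theorem IsAddEndo.algLe_map {p : M → M} (hp : IsAddEndo p) {a b : M} (hab : algLe a b) :
    algLe (p a) (p b) := by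
  obtain ⟨c, rfl⟩ := hab
  exact ⟨p c, (hp.2 a c).symm⟩

/-- Under refinement, an element below `b + c` splits into parts below `b` and below `c`. -/
theorem Refinement.exists_eq_add_of_algLe_add (hRef : Refinement M) {a b c : M}
    (h : algLe a (b + c)) : ∃ a₀ a₁ : M, a = a₀ + a₁ ∧ algLe a₀ b ∧ algLe a₁ c := by
  obtain ⟨d, hd⟩ := h
  obtain ⟨c₀₀, c₀₁, c₁₀, c₁₁, ha, -, hb, hc⟩ := hRef a d b c hd
  exact ⟨c₀₀, c₀₁, ha, ⟨c₁₀, hb.symm⟩, ⟨c₁₁, hc.symm⟩⟩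

namespace IsProjection

variable {p q : M → M}

theorem algLe_self (hp : IsProjection p) (x : M) : algLe (p x) x := by
  obtain ⟨y, hy, -⟩ := hp.2 x
  exact ⟨y, hy.symm⟩

theorem exists_eq_add (hp : IsProjection p) (x : M) : ∃ y : M, x = p x + y ∧ p y = 0 := by
  obtain ⟨y, hy, hperp⟩ := hp.2 x
  exact ⟨y, hy, hperp y _ (hp.algLe_self y) (algLe_refl _)⟩

theorem eq_zero_of_algLe_map (hp : IsProjection p) {z s : M} (hz : p z = 0)
    (hzs : algLe z (p s)) : z = 0 := by
  obtain ⟨y, hy, hperp⟩ := hp.2 z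
  rw [hz, zero_add] at hy
  subst hy
  exact hperp s z (algLe_refl z) hzs

theorem map_map_eq_zero_symm (hp : IsProjection p) (hq : IsProjection q)
    (hpq : ∀ x, p (q x) = 0) (x : M) : q (p x) = 0 :=
  hp.eq_zero_of_algLe_map (hpq _) (hq.algLe_self (p x))

/-- Every element is the sum of its images under two orthogonal projections and an element
killed by both. -/
theorem exists_eq_add_add (hCon : Conical M) (hp : IsProjection p) (hq : IsProjection q)
    (hpq : ∀ x, p (q x) = 0) (x : M) :
    ∃ w : M, x = p x + q x + w ∧ p w = 0 ∧ q w = 0 := by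
  obtain ⟨y, hy, hpy⟩ := hp.exists_eq_add x
  obtain ⟨w, hw, hqw⟩ := hq.exists_eq_add y
  have hqx : q x = q y := by
    conv_lhs => rw [hy, hq.1.2, hp.map_map_eq_zero_symm hq hpq, zero_add]
  have hwy : algLe w y := ⟨q y, (add_comm _ _).trans hw.symm⟩
  refine ⟨w, ?_, hCon.eq_zero_of_algLe (hp.1.algLe_map hwy) hpy, hqw⟩
  rw [hqx, add_assoc, ← hw, ← hy]

theorem add (hCon : Conical M) (hRef : Refinement M) (hp : IsProjection p)
    (hq : IsProjection q) (hpq : ∀ x, p (q x) = 0) : IsProjection (fun x => p x + q x) := by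
  refine ⟨⟨by simp [hp.1.1, hq.1.1], fun x y => ?_⟩, fun x => ?_⟩
  · simp only [hp.1.2, hq.1.2]
    exact add_add_add_comm _ _ _ _
  obtain ⟨w, hw, hpw, hqw⟩ := hp.exists_eq_add_add hCon hq hpq x
  refine ⟨w, hw, fun s z hzw hzs => ?_⟩
  obtain ⟨a, b, rfl, ha, hb⟩ := hRef.exists_eq_add_of_algLe_add hzs
  have hpa := hCon.eq_zero_of_algLe (hp.1.algLe_map ((algLe_add_right a b).trans hzw)) hpw
  have hqb := hCon.eq_zero_of_algLe (hq.1.algLe_map ((algLe_add_left a b).trans hzw)) hqw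
  rw [hp.eq_zero_of_algLe_map hpa ha, hq.eq_zero_of_algLe_map hqb hb, add_zero]

theorem map_map_eq_of_algLe (hCon : Conical M) (hp : IsProjection p) {t : M → M}
    (ht : IsProjection t) (hpt : ∀ x, algLe (p x) (t x)) (x : M) : p (t x) = p x := by
  obtain ⟨v, hv, htv⟩ := ht.exists_eq_add x
  conv_rhs => rw [hv, hp.1.2, hCon.eq_zero_of_algLe (hpt v) htv, add_zero]

end IsProjection

theorem statement3 (hCon : Conical M) (hRef : Refinement M)
    (p q : M → M) (hp : IsProjection p) (hq : IsProjection q)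
    (hpq : ∀ x : M, p (q x) = 0) :
    IsProjection (fun x => p x + q x) ∧
    (∀ x : M, algLe (p x) (p x + q x) ∧ algLe (q x) (p x + q x)) ∧
    (∀ t : M → M, IsProjection t →
      (∀ x : M, algLe (p x) (t x)) → (∀ x : M, algLe (q x) (t x)) →
      ∀ x : M, algLe (p x + q x) (t x)) := by
  refine ⟨hp.add hCon hRef hq hpq, fun x => ⟨algLe_add_right _ _, algLe_add_left _ _⟩,
    fun t ht hpt hqt x => ?_⟩
  obtain ⟨w, hw, -⟩ := hp.exists_eq_add_add hCon hq hpq (t x)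
  rw [hp.map_map_eq_of_algLe hCon ht hpt, hq.map_map_eq_of_algLe hCon ht hqt] at hw
  exact ⟨w, hw.symm⟩

end PaperCDS
end

section
/- Let S be a conical refinement commutative monoid whose algebraic preorder is antisymmetric, in which every nonempty subset has an infimum, which has general comparability, is Boolean-valued, and in which every element is the sum of a directly finite element and a purely infinite element. Then for every family (p_i, q_i)_{i∈I} of complementary pairs of projections of S there exists a complementary pair of projections (p, q) such that: (1) p_i(x) ≤ p(x) for all i ∈ I and x ∈ S; (2) every complementary pair (r, s) with p_i(x) ≤ r(x) for all i ∈ I and x ∈ S satisfies p(x) ≤ r(x) for all x ∈ S; (3) for every x ∈ S, p(x) is a supremum of {p_i(x) : i ∈ I} with respect to the algebraic preorder; (4) if I is nonempty, then for every x ∈ S, q(x) is an infimum of {q_i(x) : i ∈ I}. (In particular, the Boolean algebra of projections of S is complete.) -/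
namespace PaperCDS

variable {M : Type*} [AddCommMonoid M]

theorem Conical.eq_zero_of_algLe_zero (hCon : Conical M) {a : M} (h : algLe a 0) : a = 0 := by
  obtain ⟨c, hc⟩ := h
  exact (hCon a c hc).1

theorem IsAddEndo.algLe {p : M → M} (hp : IsAddEndo p) {a b : M} (h : algLe a b) :
    algLe (p a) (p b) := by
  obtain ⟨c, rfl⟩ := h
  exact ⟨p c, (hp.2 a c).symm⟩

namespace ComplPair

variable {p q : M → M}

theorem fst_algLe (h : ComplPair p q) (x : M) : algLe (p x) x := ⟨q x, (h.2.2 x).1⟩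

theorem snd_algLe (h : ComplPair p q) (x : M) : algLe (q x) x :=
  ⟨p x, by rw [add_comm]; exact (h.2.2 x).1⟩

theorem snd_eq_self (h : ComplPair p q) {x : M} (hx : p x = 0) : q x = x := by
  have := (h.2.2 x).1
  rwa [hx, zero_add] at this

theorem fst_eq_self (h : ComplPair p q) {x : M} (hx : q x = 0) : p x = x := by
  have := (h.2.2 x).1
  rwa [hx, add_zero] at this

end ComplPair

/-- In a conical refinement monoid, a submonoid `J` closed downwards such that every element is
the sum of an element orthogonal to `J` and an element of `J` is the range of a projection. -/
theorem exists_complPair_of_decomposition (hCon : Conical M) (hRef : Refinement M) {J : Set M}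
    (zero_mem : (0 : M) ∈ J) (add_mem : ∀ a ∈ J, ∀ b ∈ J, a + b ∈ J)
    (mem_of_algLe : ∀ a, ∀ b ∈ J, algLe a b → a ∈ J)
    (hdec : ∀ x : M, ∃ z y : M, z + y = x ∧ (∀ u ∈ J, algLe u z → u = 0) ∧ y ∈ J) :
    ∃ P Q : M → M, ComplPair P Q ∧ (∀ x, ∀ u ∈ J, algLe u (P x) → u = 0) ∧ ∀ x, Q x ∈ J := by
  choose P Q hPQ hP hQ using hdec
  have unique : ∀ x z y : M, z + y = x → (∀ u ∈ J, algLe u z → u = 0) → y ∈ J →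
      P x = z ∧ Q x = y := by
    intro x z y h hz hy
    obtain ⟨a, b, c, d, hPx, hQx, hza, hyb⟩ := hRef (P x) (Q x) z y ((hPQ x).trans h.symm)
    have hb : b = 0 := hP x b (mem_of_algLe b y hy ⟨d, hyb.symm⟩) ⟨a, by rw [hPx, add_comm]⟩
    have hc : c = 0 := hz c (mem_of_algLe c (Q x) (hQ x) ⟨d, hQx.symm⟩)
      ⟨a, by rw [hza, add_comm]⟩
    exact ⟨by rw [hPx, hza, hb, hc], by rw [hQx, hyb, hb, hc]⟩
  have orth_zero : ∀ u ∈ J, algLe u 0 → u = 0 := fun u _ hu => hCon.eq_zero_of_algLe_zero hu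
  have add_orth : ∀ x y : M, ∀ u ∈ J, algLe u (P x + P y) → u = 0 := by
    rintro x y u hu ⟨v, hv⟩
    obtain ⟨a, b, c, d, hua, -, hx, hy⟩ := hRef u v (P x) (P y) hv
    have ha : a = 0 := hP x a (mem_of_algLe a u hu ⟨b, hua.symm⟩) ⟨c, hx.symm⟩
    have hb : b = 0 := hP y b (mem_of_algLe b u hu ⟨a, by rw [hua, add_comm]⟩) ⟨d, hy.symm⟩
    rw [hua, ha, hb, add_zero]
  have zero_dec := unique 0 0 0 (add_zero 0) orth_zero zero_mem
  have add_dec : ∀ x y, P (x + y) = P x + P y ∧ Q (x + y) = Q x + Q y := fun x y =>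
    unique _ _ _ (by rw [add_add_add_comm, hPQ, hPQ]) (add_orth x y) (add_mem _ (hQ x) _ (hQ y))
  exact ⟨P, Q, ⟨⟨zero_dec.1, fun x y => (add_dec x y).1⟩, ⟨zero_dec.2, fun x y => (add_dec x y).2⟩,
    fun x => ⟨hPQ x, (unique (Q x) 0 (Q x) (zero_add _) orth_zero (hQ x)).1,
      (unique (P x) (P x) 0 (add_zero _) (hP x) zero_mem).2⟩⟩, hP, hQ⟩

/-- The common kernel of a family of projections is complemented by its orthogonal. -/
theorem exists_complPair_common_kernel (hCon : Conical M) (hRef : Refinement M)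
    (hM2 : AxiomM2 M) (hBV : BoolValued M)
    {I : Type*} (p q : I → M → M) (hpq : ∀ i, ComplPair (p i) (q i)) :
    ∃ P Q : M → M, ComplPair P Q ∧
      (∀ x u, (∀ i, p i u = 0) → algLe u (P x) → u = 0) ∧ ∀ x i, p i (Q x) = 0 := by
  have ker_of_algLe : ∀ {i : I} {a b : M}, p i b = 0 → algLe a b → p i a = 0 := by
    intro i a b hb hab
    apply hCon.eq_zero_of_algLe_zero
    rw [← hb]
    exact (hpq i).1.algLe hab
  refine exists_complPair_of_decomposition hCon hRef (J := {u | ∀ i, p i u = 0})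
    (fun i => (hpq i).1.1) (fun a ha b hb i => by rw [(hpq i).1.2, ha i, hb i, add_zero])
    (fun a b hb hab i => ker_of_algLe (hb i) hab) fun x => ?_
  obtain ⟨y, hy, hmax⟩ := hM2 (insert x (Set.range fun i => q i x)) ⟨x, Set.mem_insert _ _⟩
  have py : ∀ i, p i y = 0 := fun i =>
    ker_of_algLe ((hpq i).2.2 x).2.1 (hy _ (Set.mem_insert_of_mem _ ⟨i, rfl⟩))
  obtain ⟨r, s, hrs, hry, hr⟩ := hBV y 0
  rw [hrs.1.1] at hry
  have ry : r y = 0 := hCon.eq_zero_of_algLe_zero hry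
  have p_le_r : ∀ i x, algLe (p i x) (r x) := fun i =>
    hr (p i) (q i) (hpq i) (by rw [py i]; exact ⟨_, zero_add _⟩)
  refine ⟨r x, s x, (hrs.2.2 x).1, fun u hu hux => ?_, fun i => ?_⟩
  · have su : s u = 0 := by
      apply hCon.eq_zero_of_algLe_zero
      rw [← (hrs.2.2 x).2.2]
      exact hrs.2.1.algLe hux
    have huy : algLe u y := by
      apply hmax
      rintro _ (rfl | ⟨i, rfl⟩)
      · exact hux.trans (hrs.fst_algLe _)
      · rw [← (hpq i).snd_eq_self (hu i)]
        exact (hpq i).2.1.algLe (hux.trans (hrs.fst_algLe _))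
    apply hCon.eq_zero_of_algLe_zero
    rw [← hrs.fst_eq_self su, ← ry]
    exact hrs.1.algLe huy
  · apply hCon.eq_zero_of_algLe_zero
    rw [← (hrs.2.2 x).2.1]
    exact p_le_r i (s x)

theorem statement16 (hCon : Conical M) (hRef : Refinement M)
    (hAnti : Antisymm M) (hM2 : AxiomM2 M) (hGC : GenComp M)
    (hBV : BoolValued M) (hM5 : AxiomM5 M)
    {I : Type*} (p q : I → M → M) (hpq : ∀ i, ComplPair (p i) (q i)) :
    ∃ P Q : M → M, ComplPair P Q ∧
      (∀ i : I, ∀ x : M, algLe (p i x) (P x)) ∧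
      (∀ R T : M → M, ComplPair R T → (∀ i : I, ∀ x : M, algLe (p i x) (R x)) →
        ∀ x : M, algLe (P x) (R x)) ∧
      (∀ x : M, IsSupOf (P x) (Set.range fun i => p i x)) ∧
      (Nonempty I → ∀ x : M, IsInfOf (Q x) (Set.range fun i => q i x)) := by
  obtain ⟨P, Q, hPQ, hP, hQ⟩ := exists_complPair_common_kernel hCon hRef hM2 hBV p q hpq
  have pP : ∀ i x, p i (P x) = p i x := by
    intro i x
    conv_rhs => rw [← (hPQ.2.2 x).1, (hpq i).1.2, hQ x i, add_zero]
  have P_fixed : ∀ R T : M → M, ComplPair R T → (∀ i x, algLe (p i x) (R x)) →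
      ∀ x, R (P x) = P x := by
    intro R T hRT hR x
    apply hRT.fst_eq_self
    refine hP x _ (fun i => hCon.eq_zero_of_algLe_zero ?_) (hRT.snd_algLe _)
    rw [← (hRT.2.2 (P x)).2.1]
    exact hR i _
  have p_le_P : ∀ i x, algLe (p i x) (P x) := by
    intro i x
    rw [← pP i x]
    exact (hpq i).fst_algLe _
  refine ⟨P, Q, hPQ, p_le_P, fun R T hRT hR x => ?_, fun x => ⟨?_, fun y hy => ?_⟩,
    fun hI x => ⟨?_, fun y hy => ?_⟩⟩
  · rw [← P_fixed R T hRT hR x]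
    exact hRT.1.algLe (hPQ.fst_algLe x)
  · rintro _ ⟨i, rfl⟩
    exact p_le_P i x
  · obtain ⟨r, s, hrs, hle, hr⟩ := hBV (P x) y
    have p_le_r : ∀ i z, algLe (p i z) (r z) := by
      refine fun i => hr (p i) (q i) (hpq i) ?_
      rw [pP, ← (hpq i).fst_eq_self ((hpq i).2.2 x).2.2]
      exact (hpq i).1.algLe (hy _ ⟨i, rfl⟩)
    rw [← P_fixed r s hrs p_le_r x]
    exact hle.trans (hrs.fst_algLe y)
  · rintro _ ⟨i, rfl⟩
    rw [← (hpq i).snd_eq_self (hQ x i)]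
    exact (hpq i).2.1.algLe (hPQ.snd_algLe x)
  · have py : ∀ i, p i y = 0 := by
      intro i
      apply hCon.eq_zero_of_algLe_zero
      rw [← ((hpq i).2.2 x).2.1]
      exact (hpq i).1.algLe (hy _ ⟨i, rfl⟩)
    have Py : P y = 0 := hP y _ (fun i => by rw [pP, py i]) ⟨0, add_zero _⟩
    obtain ⟨i⟩ := hI
    rw [← hPQ.snd_eq_self Py]
    exact hPQ.2.1.algLe ((hy _ ⟨i, rfl⟩).trans ((hpq i).snd_algLe x))

end PaperCDS
end
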